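/- arXiv:2211.03713 — 2 statements merged into one kernel-verified Lean document; each statement's English description precedes it below -/
import Mathlib

section
/- Let M be a smooth manifold (more generally, any paracompact Hausdorff topological space), F a finite-dimensional real normed vector space, and E a topological vector bundle over M × [0,1] with typical fiber F. Then there exists a family of continuous linear isomorphisms φ_{x,t} : E_{(x,0)} → E_{(x,t)}, defined for (x,t) ∈ M × [0,1], such that φ_{x,0} = id for all x and the map (x, t, v) ↦ (x, t, φ_{x,t} v), from the total space of the pullback of the bundle E_0 = E|_{M×{0}} along the projection M × [0,1] → M × {0} to the total space of E, is a homeomorphism which is fiberwise linear and covers the identity of M × [0,1]. In particular, the restricted bundles E_0 and E_1 over M (the pullbacks of E along x ↦ (x,0) and x ↦ (x,1)) are isomorphic topological vector bundles. -/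
open Bundle

namespace BundleFamily

open ContinuousLinearMap Topology Filter

theorem eventually_mem_baseSet {B Y : Type*} (F : Type*) (E : B → Type*) [TopologicalSpace B]
    [TopologicalSpace Y] [TopologicalSpace F] [TopologicalSpace (TotalSpace F E)]
    [∀ p, TopologicalSpace (E p)] [FiberBundle F E] {f : Y → B} (hf : Continuous f) (y₀ : Y) :
    ∀ᶠ y in 𝓝 y₀, f y ∈ (trivializationAt F E (f y₀)).baseSet :=
  hf.continuousAt.eventually_mem
    ((trivializationAt F E (f y₀)).open_baseSet.mem_nhds (mem_baseSet_trivializationAt F E (f y₀)))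

section Family

variable {B Y Z F : Type*} {E : B → Type*} [TopologicalSpace B] [TopologicalSpace Y]
  [TopologicalSpace Z] [NormedAddCommGroup F] [NormedSpace ℝ F]
  [TopologicalSpace (TotalSpace F E)] [∀ p, TopologicalSpace (E p)]
  [∀ p, AddCommGroup (E p)] [∀ p, Module ℝ (E p)] [FiberBundle F E] [VectorBundle ℝ F E]

variable (F) in
/-- A family of continuous linear maps between fibers of a vector bundle, over the base maps `f`
and `g`, is continuous when it is continuous in the coordinates around each parameter. -/
def IsContinuousFamily (f g : Y → B) (A : ∀ y, E (f y) →L[ℝ] E (g y)) : Prop :=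
  ∀ y₀, ContinuousAt
    (fun y => inCoordinates F E F E (f y₀) (f y) (g y₀) (g y) (A y)) y₀

variable {f g h : Y → B}

namespace IsContinuousFamily

variable {A : ∀ y, E (f y) →L[ℝ] E (g y)}

theorem reparam (hA : IsContinuousFamily F f g A) {k : Z → Y} (hk : Continuous k) :
    IsContinuousFamily F (fun z => f (k z)) (fun z => g (k z)) (fun z => A (k z)) :=
  fun z₀ => (hA (k z₀)).comp hk.continuousAt

theorem comp {A₂ : ∀ y, E (g y) →L[ℝ] E (h y)} (hA₂ : IsContinuousFamily F g h A₂)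
    (hA : IsContinuousFamily F f g A) (hg : Continuous g) :
    IsContinuousFamily F f h (fun y => (A₂ y).comp (A y)) := by
  intro y₀
  refine ((hA₂ y₀).clm_comp (hA y₀)).congr ?_
  filter_upwards [eventually_mem_baseSet F E hg y₀] with y hy
  ext v
  simp [inCoordinates, hy]

theorem congr_of_eventually {A₂ : ∀ y, E (f y) →L[ℝ] E (g y)}
    (H : ∀ y₀, ∃ A₃ : ∀ y, E (f y) →L[ℝ] E (g y), IsContinuousFamily F f g A₃ ∧
      ∀ᶠ y in 𝓝 y₀, A₃ y = A₂ y) :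
    IsContinuousFamily F f g A₂ := by
  intro y₀
  obtain ⟨A₃, h, he⟩ := H y₀
  refine (h y₀).congr ?_
  filter_upwards [he] with y hy
  rw [hy]

theorem continuous_pullback (hA : IsContinuousFamily F f g A) (hg : Continuous g) :
    Continuous (fun z : TotalSpace F (f *ᵖ E) =>
      (⟨g z.proj, A z.proj z.2⟩ : TotalSpace F E)) := by
  rw [continuous_iff_continuousAt]
  intro z₀
  have hp : Continuous (TotalSpace.proj : TotalSpace F (f *ᵖ E) → Y) :=
    Pullback.continuous_proj F E f
  exact ContinuousAt.clm_apply_of_inCoordinates (b₁ := fun z : TotalSpace F (f *ᵖ E) => f z.proj)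
    (b₂ := fun z => g z.proj) (ϕ := fun z => A z.proj) (v := fun z => z.2)
    (hA.reparam hp z₀) (Pullback.continuous_lift F E f).continuousAt (hg.comp hp).continuousAt

theorem continuous_pullback_pullback (hA : IsContinuousFamily F f g A) (hg : Continuous g) :
    Continuous (fun z : TotalSpace F (f *ᵖ E) =>
      (⟨z.proj, A z.proj z.2⟩ : TotalSpace F (g *ᵖ E))) :=
  (inducing_pullbackTotalSpaceEmbedding F E g).continuous_iff.2
    ((Pullback.continuous_proj F E f).prodMk (hA.continuous_pullback hg))

variable [CompleteSpace F]

theorem eventually_isInvertible (hA : IsContinuousFamily F f g A) (hf : Continuous f)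
    (hg : Continuous g) {y₀ : Y} (h₀ : (A y₀).IsInvertible) :
    ∀ᶠ y in 𝓝 y₀, (A y).IsInvertible := by
  obtain ⟨a, ha⟩ := h₀
  have hf₀ := mem_baseSet_trivializationAt F E (f y₀)
  have hg₀ := mem_baseSet_trivializationAt F E (g y₀)
  have key := (hA y₀).eventually_mem (s := Set.range ((↑) : (F ≃L[ℝ] F) → F →L[ℝ] F)) <| by
    rw [inCoordinates_eq hf₀ hg₀, ← ha]
    exact ContinuousLinearEquiv.nhds
      ((((trivializationAt F E (f y₀)).continuousLinearEquivAt ℝ _ hf₀).symm.trans a).trans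
        ((trivializationAt F E (g y₀)).continuousLinearEquivAt ℝ _ hg₀))
  filter_upwards [key, eventually_mem_baseSet F E hf y₀, eventually_mem_baseSet F E hg y₀]
    with y ⟨b, hb⟩ hfy hgy
  rw [inCoordinates_eq hfy hgy] at hb
  refine ⟨(((trivializationAt F E (f y₀)).continuousLinearEquivAt ℝ _ hfy).trans b).trans
    ((trivializationAt F E (g y₀)).continuousLinearEquivAt ℝ _ hgy).symm, ?_⟩
  ext v
  have := congrArg (fun T : F →L[ℝ] F =>
    T ((trivializationAt F E (f y₀)).continuousLinearEquivAt ℝ _ hfy v)) hb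
  simp only [ContinuousLinearMap.comp_apply, ContinuousLinearEquiv.coe_coe,
    ContinuousLinearEquiv.symm_apply_apply] at this
  simp only [ContinuousLinearEquiv.coe_coe, ContinuousLinearEquiv.trans_apply, this,
    ContinuousLinearEquiv.symm_apply_apply]

theorem symm {a : ∀ y, E (f y) ≃L[ℝ] E (g y)}
    (ha : IsContinuousFamily F f g (fun y => (a y : E (f y) →L[ℝ] E (g y))))
    (hf : Continuous f) (hg : Continuous g) :
    IsContinuousFamily F g f (fun y => ((a y).symm : E (g y) →L[ℝ] E (f y))) := by
  intro y₀
  have hf₀ := mem_baseSet_trivializationAt F E (f y₀)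
  have hg₀ := mem_baseSet_trivializationAt F E (g y₀)
  have hinv : ContinuousAt (ContinuousLinearMap.inverse : (F →L[ℝ] F) → F →L[ℝ] F)
      (inCoordinates F E F E (f y₀) (f y₀) (g y₀) (g y₀) (a y₀)) := by
    rw [inCoordinates_eq hf₀ hg₀]
    exact (contDiffAt_map_inverse (𝕜 := ℝ) (n := 0)
      ((((trivializationAt F E (f y₀)).continuousLinearEquivAt ℝ _ hf₀).symm.trans (a y₀)).trans
        ((trivializationAt F E (g y₀)).continuousLinearEquivAt ℝ _ hg₀))).continuousAt
  refine (ContinuousAt.comp (x := y₀) hinv (ha y₀)).congr ?_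
  filter_upwards [eventually_mem_baseSet F E hf y₀, eventually_mem_baseSet F E hg y₀]
    with y hfy hgy
  rw [Function.comp_apply, inCoordinates_eq hfy hgy, inCoordinates_eq hgy hfy]
  exact ContinuousLinearMap.inverse_equiv
    ((((trivializationAt F E (f y₀)).continuousLinearEquivAt ℝ _ hfy).symm.trans (a y)).trans
      ((trivializationAt F E (g y₀)).continuousLinearEquivAt ℝ _ hgy))

theorem isHomeomorph_pullback {a : ∀ y, E (f y) ≃L[ℝ] E (g y)}
    (ha : IsContinuousFamily F f g (fun y => (a y : E (f y) →L[ℝ] E (g y))))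
    (hf : Continuous f) (hg : Continuous g) :
    IsHomeomorph (fun z : TotalSpace F (f *ᵖ E) =>
      (⟨z.proj, a z.proj z.2⟩ : TotalSpace F (g *ᵖ E))) :=
  isHomeomorph_iff_exists_inverse.2 ⟨ha.continuous_pullback_pullback hg,
    fun z => ⟨z.proj, (a z.proj).symm z.2⟩,
    fun z => congrArg (TotalSpace.mk z.proj) ((a z.proj).symm_apply_apply z.2),
    fun z => congrArg (TotalSpace.mk z.proj) ((a z.proj).apply_symm_apply z.2),
    (ha.symm hf hg).continuous_pullback_pullback hf⟩

theorem isHomeomorph_of_id {f : B → B} {a : ∀ p, E (f p) ≃L[ℝ] E p}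
    (ha : IsContinuousFamily F f id (fun p => (a p : E (f p) →L[ℝ] E p))) (hf : Continuous f) :
    IsHomeomorph (fun z : TotalSpace F (f *ᵖ E) =>
      (⟨z.proj, a z.proj z.2⟩ : TotalSpace F E)) := by
  refine isHomeomorph_iff_exists_inverse.2 ⟨ha.continuous_pullback continuous_id,
    fun z => ⟨z.proj, (a z.proj).symm z.2⟩,
    fun z => congrArg (TotalSpace.mk z.proj) ((a z.proj).symm_apply_apply z.2),
    fun z => congrArg (TotalSpace.mk z.proj) ((a z.proj).apply_symm_apply z.2), ?_⟩
  refine (inducing_pullbackTotalSpaceEmbedding F E f).continuous_iff.2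
    ((FiberBundle.continuous_proj F E).prodMk (continuous_iff_continuousAt.2 fun z₀ => ?_))
  exact ContinuousAt.clm_apply_of_inCoordinates (b₁ := fun z : TotalSpace F E => z.proj)
    (b₂ := fun z => f z.proj) (ϕ := fun z => ((a z.proj).symm : E z.proj →L[ℝ] E (f z.proj)))
    (v := fun z => z.2)
    ((ha.symm hf continuous_id).reparam (FiberBundle.continuous_proj F E) z₀)
    continuousAt_id (hf.comp (FiberBundle.continuous_proj F E)).continuousAt

end IsContinuousFamily


/-- A vector bundle over a paracompact Hausdorff base admits linear maps `E p → E q`,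
depending continuously on `(p, q)` and equal to the identity on the diagonal. -/
theorem exists_transport [ParacompactSpace B] [T2Space B] :
    ∃ Q : ∀ p q : B, E p →L[ℝ] E q, (∀ p, Q p p = ContinuousLinearMap.id ℝ (E p)) ∧
      IsContinuousFamily F (Prod.fst : B × B → B) Prod.snd (fun y => Q y.1 y.2) := by
  have hgrp (p : B) : IsTopologicalAddGroup (E p) :=
    let e := VectorBundle.continuousLinearEquivAt ℝ F E p
    e.toHomeomorph.isInducing.topologicalAddGroup e.toLinearEquiv.toAddEquiv
  have hsmul (p : B) : ContinuousSMul ℝ (E p) :=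
    let e := VectorBundle.continuousLinearEquivAt ℝ F E p
    e.toHomeomorph.isInducing.continuousSMul continuous_id (fun {c x} => map_smul e c x)
  obtain ⟨ρ, hρ⟩ := PartitionOfUnity.exists_isSubordinate (s := Set.univ) isClosed_univ
    (fun i : B => (trivializationAt F E i).baseSet)
    (fun i => (trivializationAt F E i).open_baseSet)
    (fun p _ => Set.mem_iUnion.2 ⟨p, mem_baseSet_trivializationAt F E p⟩)
  let T (i p q : B) : E p →L[ℝ] E q := (√(ρ i p) * √(ρ i q)) •
    ((trivializationAt F E i).symmL ℝ q).comp ((trivializationAt F E i).continuousLinearMapAt ℝ p)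
  have hT (i : B) : IsContinuousFamily F (Prod.fst : B × B → B) Prod.snd
      (fun y => T i y.1 y.2) := by
    intro y₀
    by_cases hy : y₀.1 ∈ tsupport (ρ i) ∧ y₀.2 ∈ tsupport (ρ i)
    · have hp := hρ i hy.1
      have hq := hρ i hy.2
      have hcoord₁ : ContinuousAt (fun y : B × B =>
          ((trivializationAt F E y₀.1).coordChangeL ℝ (trivializationAt F E i) y.1 :
            F →L[ℝ] F)) y₀ :=
        ContinuousAt.comp (x := y₀) (f := Prod.fst) ((continuousOn_coordChange ℝ
           (trivializationAt F E y₀.1)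
          (trivializationAt F E i)).continuousAt
          (((trivializationAt F E y₀.1).open_baseSet.inter
            (trivializationAt F E i).open_baseSet).mem_nhds
            ⟨mem_baseSet_trivializationAt F E y₀.1, hp⟩)) continuousAt_fst
      have hcoord₂ : ContinuousAt (fun y : B × B =>
          ((trivializationAt F E i).coordChangeL ℝ (trivializationAt F E y₀.2) y.2 :
            F →L[ℝ] F)) y₀ :=
        ContinuousAt.comp (x := y₀) (f := Prod.snd) ((continuousOn_coordChange ℝ
           (trivializationAt F E i)
          (trivializationAt F E y₀.2)).continuousAt
          (((trivializationAt F E i).open_baseSet.inter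
            (trivializationAt F E y₀.2).open_baseSet).mem_nhds
            ⟨hq, mem_baseSet_trivializationAt F E y₀.2⟩)) continuousAt_snd
      have hscal : ContinuousAt (fun y : B × B => √(ρ i y.1) * √(ρ i y.2)) y₀ := by
        fun_prop
      refine (hscal.smul (hcoord₂.clm_comp hcoord₁)).congr ?_
      filter_upwards [eventually_mem_baseSet F E continuous_fst y₀,
        eventually_mem_baseSet F E continuous_snd y₀,
        continuousAt_fst.eventually_mem ((trivializationAt F E i).open_baseSet.mem_nhds hp),
        continuousAt_snd.eventually_mem ((trivializationAt F E i).open_baseSet.mem_nhds hq)]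
        with y h₁ h₂ h₃ h₄
      ext v
      simp [T, inCoordinates, Trivialization.coordChangeL_apply, Trivialization.symmL_apply,
        Trivialization.continuousLinearMapAt_apply_of_mem, h₁, h₂, h₃, h₄]
    · have hzero : ∀ᶠ y : B × B in 𝓝 y₀, √(ρ i y.1) * √(ρ i y.2) = 0 := by
        rw [not_and_or] at hy
        rcases hy with hy | hy
        · filter_upwards [continuousAt_fst.eventually (notMem_tsupport_iff_eventuallyEq.1 hy)]
            with y hy
          simp [hy]
        · filter_upwards [continuousAt_snd.eventually (notMem_tsupport_iff_eventuallyEq.1 hy)]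
            with y hy
          simp [hy]
      refine (continuousAt_const (y := (0 : F →L[ℝ] F))).congr ?_
      filter_upwards [hzero] with y hy
      simp [T, hy, inCoordinates]
  refine ⟨fun p q => ∑ i ∈ ρ.finsupport p, T i p q, fun p => ?_, ?_⟩
  · ext v
    have hterm (i) (hi : i ∈ ρ.finsupport p) : T i p p v = ρ i p • v := by
      have hmem : p ∈ (trivializationAt F E i).baseSet :=
        hρ i (subset_tsupport _ ((ρ.mem_finsupport p).1 hi))
      simp [T, hmem, Real.mul_self_sqrt (ρ.nonneg i p)]
    rw [sum_apply, Finset.sum_congr rfl hterm, ← Finset.sum_smul,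
      ρ.sum_finsupport (Set.mem_univ p), one_smul, ContinuousLinearMap.id_apply]
  · refine IsContinuousFamily.congr_of_eventually fun y₀ =>
      ⟨fun y => ∑ i ∈ ρ.fintsupport y₀.1, T i y.1 y.2, fun y₁ => ?_, ?_⟩
    · have hsum (y : B × B) : inCoordinates F E F E y₁.1 y.1 y₁.2 y.2
          (∑ i ∈ ρ.fintsupport y₀.1, T i y.1 y.2) =
          ∑ i ∈ ρ.fintsupport y₀.1, inCoordinates F E F E y₁.1 y.1 y₁.2 y.2 (T i y.1 y.2) := by
        ext v
        simp [inCoordinates]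
      simp only [hsum]
      exact tendsto_finsetSum _ fun i _ => hT i y₁
    · filter_upwards [continuousAt_fst.eventually (ρ.eventually_finsupport_subset y₀.1)] with y hy
      refine (Finset.sum_subset hy fun i _ hi => ?_).symm
      have hi : ρ i y.1 = 0 := by simpa [ρ.mem_finsupport] using hi
      simp [T, hi]

end Family

section Cylinder

variable {M F : Type*} {E : M × unitInterval → Type*}
  [∀ p, TopologicalSpace (E p)] [∀ p, AddCommGroup (E p)] [∀ p, Module ℝ (E p)]

/-- The point of the unit interval obtained by moving `t` down by `δ`, stopping at `0`. -/
noncomputable def stepBack (δ : ℝ) (t : unitInterval) : unitInterval :=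
  Set.projIcc 0 1 zero_le_one (t - δ)

theorem coe_stepBack {δ : ℝ} (hδ : 0 ≤ δ) (t : unitInterval) :
    (stepBack δ t : ℝ) = max 0 (t - δ) := by
  rw [stepBack, Set.coe_projIcc, min_eq_right (by linarith [t.2.2])]

theorem stepBack_zero {δ : ℝ} (hδ : 0 ≤ δ) : stepBack δ 0 = 0 :=
  Subtype.ext (by rw [coe_stepBack hδ]; simpa using hδ)

theorem dist_stepBack_le {δ : ℝ} (hδ : 0 ≤ δ) (t : unitInterval) : dist (stepBack δ t) t ≤ δ := by
  rw [Subtype.dist_eq, coe_stepBack hδ, Real.dist_eq, abs_le]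
  constructor
  · linarith [le_max_right 0 ((t : ℝ) - δ)]
  · have : max 0 ((t : ℝ) - δ) ≤ t := max_le t.2.1 (by linarith)
    linarith

theorem stepBack_le {δ c : ℝ} (hδ : 0 ≤ δ) (hc : 0 ≤ c) {t : unitInterval} (ht : (t : ℝ) ≤ c + δ) :
    (stepBack δ t : ℝ) ≤ c := by
  rw [coe_stepBack hδ]
  exact max_le hc (by linarith)

/-- The composition of the transports `Q` along `n` steps of size `δ x` ending at `(x, t)`,
preceded by a transport from `(x, 0)`. -/
noncomputable def iterTransport (Q : ∀ p q, E p →L[ℝ] E q) (δ : M → ℝ) :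
    ℕ → ∀ (x : M) (t : unitInterval), E (x, 0) →L[ℝ] E (x, t)
  | 0, x, t => Q (x, 0) (x, t)
  | n + 1, x, t => (Q (x, stepBack (δ x) t) (x, t)).comp (iterTransport Q δ n x (stepBack (δ x) t))

variable {Q : ∀ p q, E p →L[ℝ] E q} {δ : M → ℝ}

theorem iterTransport_zero_right (hQ : ∀ p, Q p p = ContinuousLinearMap.id ℝ (E p)) {x : M}
    (hδ : 0 ≤ δ x) (n : ℕ) : iterTransport Q δ n x 0 = ContinuousLinearMap.id ℝ (E (x, 0)) := by
  induction n with
  | zero => exact hQ _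
  | succ n ih =>
    have key (s : unitInterval) (hs : s = 0) :
        (Q (x, s) (x, 0)).comp (iterTransport Q δ n x s) = ContinuousLinearMap.id ℝ _ := by
      subst hs
      rw [hQ, ih, ContinuousLinearMap.id_comp]
    exact key _ (stepBack_zero hδ)

theorem iterTransport_succ (hQ : ∀ p, Q p p = ContinuousLinearMap.id ℝ (E p)) {x : M}
    (hδ : 0 ≤ δ x) (n : ℕ) (t : unitInterval) (ht : (t : ℝ) ≤ n * δ x) :
    iterTransport Q δ (n + 1) x t = iterTransport Q δ n x t := by
  induction n generalizing t with
  | zero =>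
    obtain rfl : t = 0 := Subtype.ext (le_antisymm (by simpa using ht) t.2.1)
    rw [iterTransport_zero_right hQ hδ, iterTransport_zero_right hQ hδ]
  | succ n ih =>
    rw [iterTransport, ih, ← iterTransport]
    exact stepBack_le hδ (by positivity) (by push_cast at ht; linarith)

theorem iterTransport_eq_of_le (hQ : ∀ p, Q p p = ContinuousLinearMap.id ℝ (E p)) {x : M}
    (hδ : 0 ≤ δ x) {n m : ℕ} (hnm : n ≤ m) (t : unitInterval) (ht : (t : ℝ) ≤ n * δ x) :
    iterTransport Q δ m x t = iterTransport Q δ n x t := by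
  induction m, hnm using Nat.le_induction with
  | base => rfl
  | succ m hm ih =>
    rw [iterTransport_succ hQ hδ m t, ih]
    exact ht.trans (by gcongr)

theorem isInvertible_iterTransport {x : M} (hδ : 0 ≤ δ x)
    (hQδ : ∀ s t, dist s t ≤ δ x → (Q (x, s) (x, t)).IsInvertible) (n : ℕ) (t : unitInterval)
    (ht : (t : ℝ) ≤ (n + 1) * δ x) : (iterTransport Q δ n x t).IsInvertible := by
  induction n generalizing t with
  | zero =>
    refine hQδ 0 t ?_
    rw [Subtype.dist_eq, Real.dist_eq, abs_le]
    constructor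
    · simpa using ht
    · simpa using (neg_nonpos.2 t.2.1).trans hδ
  | succ n ih =>
    exact (hQδ _ _ (dist_stepBack_le hδ t)).comp
      (ih _ (stepBack_le hδ (by positivity) (by push_cast at ht; linarith)))

variable [TopologicalSpace M] [NormedAddCommGroup F] [NormedSpace ℝ F]
  [TopologicalSpace (TotalSpace F E)] [FiberBundle F E] [VectorBundle ℝ F E]

theorem isContinuousFamily_iterTransport
    (hQ : IsContinuousFamily F (Prod.fst : (M × unitInterval) × (M × unitInterval) → _) Prod.snd
      (fun y => Q y.1 y.2)) (hδ : Continuous δ) (n : ℕ) :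
    IsContinuousFamily F (fun p : M × unitInterval => (p.1, (0 : unitInterval))) id
      (fun p => iterTransport Q δ n p.1 p.2) := by
  induction n with
  | zero =>
    exact hQ.reparam (k := fun p : M × unitInterval => ((p.1, (0 : unitInterval)), p))
      (by fun_prop)
  | succ n ih =>
    have hk : Continuous (fun p : M × unitInterval => (p.1, stepBack (δ p.1) p.2)) :=
      continuous_fst.prodMk (continuous_projIcc.comp (by fun_prop))
    exact (hQ.reparam (k := fun p : M × unitInterval => ((p.1, stepBack (δ p.1) p.2), p))
      (hk.prodMk continuous_id)).comp (ih.reparam hk) hk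

/-- A continuous family of maps over a cylinder which is invertible along the diagonal is
invertible for pairs of times whose distance is bounded by a continuous positive function. -/
theorem exists_continuous_step [ParacompactSpace M] [T2Space M] [CompleteSpace F]
    (hQ : ∀ p, Q p p = ContinuousLinearMap.id ℝ (E p))
    (hQc : IsContinuousFamily F (Prod.fst : (M × unitInterval) × (M × unitInterval) → _) Prod.snd
      (fun y => Q y.1 y.2)) :
    ∃ δ : C(M, ℝ), ∀ x, 0 < δ x ∧
      ∀ s t, dist s t ≤ δ x → (Q (x, s) (x, t)).IsInvertible := by
  refine exists_continuous_forall_mem_convex_of_local_const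
    (t := fun x => {d : ℝ | 0 < d ∧ ∀ s t, dist s t ≤ d → (Q (x, s) (x, t)).IsInvertible})
    (fun x => Set.OrdConnected.convex ⟨fun a ha b hb c hc =>
      ⟨ha.1.trans_le hc.1, fun s t hst => hb.2 s t (hst.trans hc.2)⟩⟩) fun x => ?_
  let k : M × (unitInterval × unitInterval) → (M × unitInterval) × (M × unitInterval) :=
    fun z => ((z.1, z.2.1), (z.1, z.2.2))
  have hk : Continuous k := by fun_prop
  have hopen : IsOpen {z : M × (unitInterval × unitInterval) |
      (Q (z.1, z.2.1) (z.1, z.2.2)).IsInvertible} := by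
    rw [isOpen_iff_mem_nhds]
    intro z hz
    exact (hQc.reparam hk).eventually_isInvertible (continuous_fst.comp hk)
      (continuous_snd.comp hk) hz
  obtain ⟨U, V, hU, hV, hxU, hdV, hUV⟩ := generalized_tube_lemma (isCompact_singleton (x := x))
    isCompact_diagonal hopen (by
      rintro ⟨y, s, t⟩ ⟨-, hst⟩
      obtain rfl : s = t := hst
      change (Q (y, s) (y, s)).IsInvertible
      rw [hQ]
      exact ⟨ContinuousLinearEquiv.refl ℝ _, rfl⟩)
  have hVu : V ∈ uniformity unitInterval := by
    rw [← nhdsSet_diagonal_eq_uniformity]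
    exact hV.mem_nhdsSet.2 hdV
  obtain ⟨ε, hε, hεV⟩ := Metric.mem_uniformity_dist.1 hVu
  refine ⟨ε / 2, ?_⟩
  filter_upwards [hU.mem_nhds (hxU rfl)] with y hy
  exact ⟨half_pos hε, fun s t hst =>
    hUV (Set.mk_mem_prod hy (hεV (hst.trans_lt (half_lt_self hε))))⟩

variable (F E) in
/-- A vector bundle over a cylinder admits a continuous parallel transport from time `0`. -/
theorem exists_equiv_cylinder [ParacompactSpace M] [T2Space M] [CompleteSpace F] :
    ∃ φ : ∀ (x : M) (t : unitInterval), E (x, 0) ≃L[ℝ] E (x, t),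
      (∀ x, φ x 0 = ContinuousLinearEquiv.refl ℝ (E (x, 0))) ∧
      IsContinuousFamily F (fun p : M × unitInterval => (p.1, (0 : unitInterval))) id
        (fun p => (φ p.1 p.2 : E (p.1, 0) →L[ℝ] E p)) := by
  obtain ⟨Q, hQ, hQc⟩ := exists_transport (F := F) (E := E)
  obtain ⟨δ, hδ⟩ := exists_continuous_step hQ hQc
  have hN (x : M) : 1 ≤ ⌈(δ x)⁻¹⌉₊ * δ x :=
    (inv_mul_cancel₀ (hδ x).1.ne').symm.le.trans
      (mul_le_mul_of_nonneg_right (Nat.le_ceil _) (hδ x).1.le)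
  have hinv (x : M) (t : unitInterval) : (iterTransport Q δ ⌈(δ x)⁻¹⌉₊ x t).IsInvertible :=
    isInvertible_iterTransport (hδ x).1.le (hδ x).2 _ _
      (by linarith [hN x, t.2.2, (hδ x).1])
  choose φ hφ using hinv
  refine ⟨φ, fun x => ContinuousLinearEquiv.coe_injective ?_, ?_⟩
  · rw [hφ, iterTransport_zero_right hQ (hδ x).1.le]
    rfl
  · simp only [hφ]
    refine IsContinuousFamily.congr_of_eventually fun p₀ =>
      ⟨_, isContinuousFamily_iterTransport hQc δ.continuous (⌈(δ p₀.1)⁻¹⌉₊ + 1), ?_⟩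
    have hlt : (δ p₀.1)⁻¹ < (⌈(δ p₀.1)⁻¹⌉₊ + 1 : ℕ) := by
      push_cast
      linarith [Nat.le_ceil (δ p₀.1)⁻¹]
    have hcont : ContinuousAt (fun p : M × unitInterval => (δ p.1)⁻¹) p₀ :=
      (δ.continuous.comp continuous_fst).continuousAt.inv₀ (hδ _).1.ne'
    filter_upwards [hcont.eventually_lt_const hlt] with p hp
    exact iterTransport_eq_of_le hQ (hδ _).1.le (Nat.ceil_le.2 hp.le) _ (p.2.2.2.trans (hN _))

end Cylinder

end BundleFamily

/-- **Lemma A.1 (stability lemma)**: a topological vector bundle `E` over `M × [0,1]`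
(`M` paracompact Hausdorff, typical fiber a finite-dimensional real normed space `F`)
admits a family of continuous linear isomorphisms `φ x t : E (x,0) ≃ E (x,t)` with
`φ x 0 = id`, whose induced total-space map — from the pullback of `E|_{M×{0}}` along the
projection `M × [0,1] → M × {0}` to `E` — is a fiberwise-linear homeomorphism covering the
identity of `M × [0,1]`.  In particular, the restrictions `E₀` and `E₁` of `E` to `M × {0}`
and `M × {1}`, viewed as bundles over `M`, are isomorphic topological vector bundles. -/
theorem bundle_over_cylinder_stability
    {M : Type*} [TopologicalSpace M] [ParacompactSpace M] [T2Space M]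
    {F : Type*} [NormedAddCommGroup F] [NormedSpace ℝ F] [FiniteDimensional ℝ F]
    (E : M × unitInterval → Type*)
    [TopologicalSpace (TotalSpace F E)] [∀ p, TopologicalSpace (E p)]
    [∀ p, AddCommGroup (E p)] [∀ p, Module ℝ (E p)]
    [FiberBundle F E] [VectorBundle ℝ F E] :
    ∃ φ : ∀ (x : M) (t : unitInterval), E (x, 0) ≃L[ℝ] E (x, t),
      -- `φ x 0` is the identity
      (∀ x : M, φ x 0 = ContinuousLinearEquiv.refl ℝ (E (x, 0))) ∧
      -- the induced fiberwise-linear total-space map, from the pullback of `E|_{M×{0}}`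
      -- along the projection `M × [0,1] → M × {0}` to `E`, covering the identity of
      -- `M × [0,1]`, is a homeomorphism
      IsHomeomorph
        (fun z : TotalSpace F ((fun p : M × unitInterval => (p.1, 0)) *ᵖ E) =>
          (⟨z.proj, φ z.proj.1 z.proj.2 z.2⟩ : TotalSpace F E)) ∧
      -- in particular `E₀ ≅ E₁` as topological vector bundles over `M`
      ∃ ψ : ∀ x : M, E (x, 0) ≃L[ℝ] E (x, 1),
        IsHomeomorph
          (fun z : TotalSpace F ((fun x : M => (x, 0)) *ᵖ E) =>
            (⟨z.proj, ψ z.proj z.2⟩ : TotalSpace F ((fun x : M => (x, 1)) *ᵖ E))) := by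
  have : CompleteSpace F := FiniteDimensional.complete ℝ F
  obtain ⟨φ, hφ₀, hφ⟩ := BundleFamily.exists_equiv_cylinder F E
  have h₀ : Continuous (fun x : M => (x, (0 : unitInterval))) := by fun_prop
  have h₁ : Continuous (fun x : M => (x, (1 : unitInterval))) := by fun_prop
  refine ⟨φ, hφ₀, ?_, fun x => φ x 1,
    (hφ.reparam h₁).isHomeomorph_pullback (a := fun x => φ x 1) h₀ h₁⟩
  exact BundleFamily.IsContinuousFamily.isHomeomorph_of_id (F := F) (E := E)
    (f := fun p : M × unitInterval => (p.1, (0 : unitInterval))) (a := fun p => φ p.1 p.2) hφ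
    (by fun_prop)
end

section
/- Let M be a smooth manifold (more generally, any paracompact Hausdorff topological space), F a finite-dimensional real normed vector space, and E a topological vector bundle over M × [0,1] with typical fiber F. Suppose in addition that ω is a continuous family of fiberwise bilinear forms on E (a continuous section of the bundle of bilinear forms on E over M × [0,1]) such that each ω_{(x,t)} : E_{(x,t)} × E_{(x,t)} → ℝ is alternating and nondegenerate. Then the family of continuous linear isomorphisms φ_{x,t} : E_{(x,0)} → E_{(x,t)} with φ_{x,0} = id, whose induced total-space map is a fiberwise-linear homeomorphism from the pullback of E|_{M×{0}} to E, can be chosen to be fiberwise symplectic: ω_{(x,t)}(φ_{x,t} u, φ_{x,t} v) = ω_{(x,0)}(u, v) for all (x,t) ∈ M × [0,1] and all u, v ∈ E_{(x,0)}. -/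
open Bundle

section Transport

open Filter Topology Set unitInterval

/-- Near `1`, a complete real normed algebra has a continuous square root; it takes values in
units, and it preserves the fixed points of any anti-multiplicative map continuous at `1`. -/
theorem exists_continuousOn_sqrt {R : Type*} [NormedRing R] [NormedAlgebra ℝ R] [CompleteSpace R]
    (τ : R → R) (hτ_one : τ 1 = 1) (hτ_mul : ∀ a b, τ (a * b) = τ b * τ a)
    (hτ : ContinuousAt τ 1) :
    ∃ W : Set R, IsOpen W ∧ 1 ∈ W ∧ ∃ g : R → R, ContinuousOn g W ∧
      ∀ a ∈ W, g a * g a = a ∧ IsUnit (g a) ∧ (τ a = a → τ (g a) = g a) := by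
  have hd : HasStrictFDerivAt (fun x : R => x * x)
      ((ContinuousLinearEquiv.smulLeft (Units.mk0 (2 : ℝ) two_ne_zero) : R ≃L[ℝ] R) : R →L[ℝ] R)
      (1 : R) := by
    refine ((hasStrictFDerivAt_id (𝕜 := ℝ) (1 : R)).mul'
      (hasStrictFDerivAt_id (1 : R))).congr_fderiv ?_
    ext x
    simp [two_smul, Units.smul_def]
  set e := hd.toOpenPartialHomeomorph (fun x : R => x * x) with he
  have h1 : (1 : R) ∈ e.source := hd.mem_toOpenPartialHomeomorph_source
  have hee : ∀ x, e x = x * x := fun x => rfl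
  have h1t : (1 : R) ∈ e.target := by simpa [hee] using e.map_source h1
  have hs1 : e.symm 1 = 1 := by
    have := e.left_inv h1
    rwa [hee, one_mul] at this
  have hc : Tendsto e.symm (𝓝 1) (𝓝 1) := by
    simpa [ContinuousAt, hs1] using e.continuousAt_symm h1t
  have hτt : Tendsto τ (𝓝 1) (𝓝 1) := by simpa [ContinuousAt, hτ_one] using hτ
  have hev : ∀ᶠ a in 𝓝 (1 : R), a ∈ e.target ∧ IsUnit (e.symm a) ∧ τ (e.symm a) ∈ e.source :=
    (e.open_target.eventually_mem h1t).and
      ((hc.eventually (Units.isOpen.eventually_mem isUnit_one)).and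
        ((hτt.comp hc).eventually (e.open_source.eventually_mem h1)))
  obtain ⟨W, hW, hWo, hW1⟩ := eventually_nhds_iff.1 hev
  refine ⟨W, hWo, hW1, e.symm, e.continuousOn_symm.mono fun a ha => (hW a ha).1, fun a ha => ?_⟩
  obtain ⟨hat, hau, has⟩ := hW a ha
  have hsq : e.symm a * e.symm a = a := by simpa [hee] using e.right_inv hat
  refine ⟨hsq, hau, fun hfix => ?_⟩
  rw [← e.left_inv has, hee, ← hτ_mul, hsq, hfix]

/-- **Local triviality of symplectic forms**: alternating forms near a nondegenerate one are
pulled back from it by invertible operators depending continuously on the form. -/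
theorem exists_continuousOn_symplectic_frame {F : Type*} [NormedAddCommGroup F] [NormedSpace ℝ F]
    [FiniteDimensional ℝ F] (Ω₀ : F →L[ℝ] F →L[ℝ] ℝ) (halt : ∀ u, Ω₀ u u = 0)
    (hnd : ∀ u, (∀ v, Ω₀ u v = 0) → u = 0) :
    ∃ W : Set (F →L[ℝ] F →L[ℝ] ℝ), IsOpen W ∧ Ω₀ ∈ W ∧
      ∃ B : (F →L[ℝ] F →L[ℝ] ℝ) → (F →L[ℝ] F), ContinuousOn B W ∧
        ∀ Ω ∈ W, IsUnit (B Ω) ∧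
          ((∀ u, Ω u u = 0) → ∀ u v, Ω₀ (B Ω u) (B Ω v) = Ω u v) := by
  have hskew : ∀ Ω : F →L[ℝ] F →L[ℝ] ℝ, (∀ u, Ω u u = 0) → ∀ u v, Ω u v = -Ω v u := by
    intro Ω h u v
    have := h (u + v)
    simp only [map_add, add_apply, h, zero_add, add_zero] at this
    linarith
  have hinj : Function.Injective (Ω₀ : F →ₗ[ℝ] F →L[ℝ] ℝ) :=
    (injective_iff_map_eq_zero _).2 fun u hu => hnd u fun v => by
      simpa using congrArg (fun f : F →L[ℝ] ℝ => f v) hu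
  have hrank : Module.finrank ℝ F = Module.finrank ℝ (F →L[ℝ] ℝ) := by
    rw [← (LinearMap.toContinuousLinearMap (𝕜 := ℝ) (E := F) (F' := ℝ)).finrank_eq]
    exact Subspace.dual_finrank_eq.symm
  let J : F ≃L[ℝ] (F →L[ℝ] ℝ) :=
    (LinearEquiv.ofInjectiveOfFinrankEq (Ω₀ : F →ₗ[ℝ] F →L[ℝ] ℝ) hinj
      hrank).toContinuousLinearEquiv
  have hJ : ∀ u, J u = Ω₀ u := fun u => rfl
  have hJs : ∀ f v, Ω₀ (J.symm f) v = f v := fun f v => by rw [← hJ, J.apply_symm_apply]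
  have hext : ∀ A C : F →L[ℝ] F, (∀ u v, Ω₀ (A u) v = Ω₀ (C u) v) → A = C := fun A C h => by
    ext u
    exact J.injective (ContinuousLinearMap.ext (h u))
  let τ : (F →L[ℝ] F) → (F →L[ℝ] F) := fun A =>
    (J.symm : (F →L[ℝ] ℝ) →L[ℝ] F).comp
      ((((ContinuousLinearMap.compL ℝ F F ℝ).flip A)).comp (J : F →L[ℝ] (F →L[ℝ] ℝ)))
  have hτ : ∀ A u v, Ω₀ (τ A u) v = Ω₀ u (A v) := fun A u v => by simp [τ, hJs, hJ]
  have hτc : Continuous τ := by fun_prop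
  obtain ⟨W, hWo, hW1, g, hg, hgW⟩ := exists_continuousOn_sqrt τ
    (hext _ _ fun u v => by simp [hτ]) (fun A C => hext _ _ fun u v => by simp [hτ])
    hτc.continuousAt
  let α : (F →L[ℝ] F →L[ℝ] ℝ) → (F →L[ℝ] F) := fun Ω =>
    (J.symm : (F →L[ℝ] ℝ) →L[ℝ] F).comp Ω
  have hα : ∀ Ω u v, Ω₀ (α Ω u) v = Ω u v := fun Ω u v => by simp [α, hJs]
  have hαc : Continuous α := by fun_prop
  refine ⟨α ⁻¹' W, hWo.preimage hαc, ?_, g ∘ α, hg.comp hαc.continuousOn fun _ h => h,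
    fun Ω hΩ => ⟨(hgW _ hΩ).2.1, fun hΩalt u v => ?_⟩⟩
  · rwa [mem_preimage, hext (α Ω₀) 1 fun u v => by simp [hα]]
  · obtain ⟨hsq, -, hfix⟩ := hgW _ hΩ
    have hself := hfix (hext _ _ fun u v => by
      rw [hτ, hskew Ω₀ halt, hα, hα, hskew Ω hΩalt, neg_neg])
    rw [Function.comp_apply, ← hτ, hself, ← mul_apply_eq_comp, hsq, hα]

/-- A continuous bundle map between vector bundles that is a linear isomorphism on each fiber is a
homeomorphism of total spaces. -/
theorem isHomeomorph_totalSpace_map {B F : Type*} [TopologicalSpace B] [NormedAddCommGroup F]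
    [NormedSpace ℝ F] [FiniteDimensional ℝ F] {E₁ E₂ : B → Type*}
    [TopologicalSpace (TotalSpace F E₁)] [∀ p, TopologicalSpace (E₁ p)]
    [∀ p, AddCommMonoid (E₁ p)] [∀ p, Module ℝ (E₁ p)] [FiberBundle F E₁] [VectorBundle ℝ F E₁]
    [TopologicalSpace (TotalSpace F E₂)] [∀ p, TopologicalSpace (E₂ p)]
    [∀ p, AddCommMonoid (E₂ p)] [∀ p, Module ℝ (E₂ p)] [FiberBundle F E₂] [VectorBundle ℝ F E₂]
    (φ : ∀ p, E₁ p ≃L[ℝ] E₂ p)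
    (hφ : Continuous fun z : TotalSpace F E₁ => (⟨z.proj, φ z.proj z.2⟩ : TotalSpace F E₂)) :
    IsHomeomorph fun z : TotalSpace F E₁ => (⟨z.proj, φ z.proj z.2⟩ : TotalSpace F E₂) := by
  refine isHomeomorph_iff_exists_inverse.2
    ⟨hφ, fun w => ⟨w.proj, (φ w.proj).symm w.2⟩, fun z => by simp, fun w => by simp, ?_⟩
  refine continuous_iff_continuousAt.2 fun w₀ => ?_
  set e₁ := trivializationAt F E₁ w₀.proj
  set e₂ := trivializationAt F E₂ w₀.proj
  let S : Set B := e₁.baseSet ∩ e₂.baseSet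
  have hS : IsOpen S := e₁.open_baseSet.inter e₂.open_baseSet
  have hw₀ : w₀.proj ∈ S :=
    ⟨mem_baseSet_trivializationAt F E₁ _, mem_baseSet_trivializationAt F E₂ _⟩
  let A : B → F →L[ℝ] F := fun p =>
    (e₂.continuousLinearMapAt ℝ p).comp ((φ p : E₁ p →L[ℝ] E₂ p).comp (e₁.symmL ℝ p))
  let A' : B → F →L[ℝ] F := fun p => Ring.inverse (A p)
  let C : B → F →L[ℝ] F := fun p =>
    (e₁.continuousLinearMapAt ℝ p).comp (((φ p).symm : E₂ p →L[ℝ] E₁ p).comp (e₂.symmL ℝ p))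
  have hAC : ∀ p ∈ S, A p * C p = 1 := by
    intro p hp
    ext v
    change e₂.continuousLinearMapAt ℝ p (φ p (e₁.symmL ℝ p
      (e₁.continuousLinearMapAt ℝ p ((φ p).symm (e₂.symmL ℝ p v))))) = v
    rw [e₁.symmL_continuousLinearMapAt hp.1, (φ p).apply_symm_apply,
      e₂.continuousLinearMapAt_symmL hp.2]
  have hCA : ∀ p ∈ S, C p * A p = 1 := by
    intro p hp
    ext v
    change e₁.continuousLinearMapAt ℝ p ((φ p).symm (e₂.symmL ℝ p
      (e₂.continuousLinearMapAt ℝ p (φ p (e₁.symmL ℝ p v))))) = v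
    rw [e₂.symmL_continuousLinearMapAt hp.2, (φ p).symm_apply_apply,
      e₁.continuousLinearMapAt_symmL hp.1]
  have hA' : ∀ p ∈ S, A' p = C p := fun p hp =>
    Ring.inverse_unit (⟨A p, C p, hAC p hp, hCA p hp⟩ : (F →L[ℝ] F)ˣ)
  have hA : ContinuousOn A S := by
    refine continuousOn_clm_apply.2 fun v => ?_
    have h₁ : ContinuousOn (fun p => (⟨p, e₁.symm p v⟩ : TotalSpace F E₁)) S :=
      e₁.continuousOn_symm.comp (f := fun p => (p, v)) (by fun_prop) fun p hp => ⟨hp.1, mem_univ _⟩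
    have h₂ := continuous_snd.comp_continuousOn (e₂.continuousOn.comp (hφ.comp_continuousOn h₁)
      fun p hp => e₂.mem_source.2 hp.2)
    refine h₂.congr fun p hp => ?_
    change e₂.linearMapAt ℝ p (φ p (e₁.symmL ℝ p v)) = _
    rw [e₂.coe_linearMapAt_of_mem hp.2, e₁.symmL_apply (R := ℝ) hp.1]
    rfl
  have hA'c : ContinuousAt A' w₀.proj :=
    ContinuousAt.comp (f := A) (g := Ring.inverse)
      (NormedRing.inverse_continuousAt (⟨A _, C _, hAC _ hw₀, hCA _ hw₀⟩ : (F →L[ℝ] F)ˣ))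
      (hA.continuousAt (hS.mem_nhds hw₀))
  have hproj : ContinuousAt (TotalSpace.proj : TotalSpace F E₂ → B) w₀ :=
    (FiberBundle.continuous_proj F E₂).continuousAt
  have hw : ContinuousAt (fun w : TotalSpace F E₂ => (e₂ w).2) w₀ :=
    (e₂.continuousAt (e₂.mem_source.2 hw₀.2)).snd
  have key : ContinuousAt (fun w : TotalSpace F E₂ =>
      (⟨w.proj, e₁.symm w.proj (A' w.proj (e₂ w).2)⟩ : TotalSpace F E₁)) w₀ := by
    refine ContinuousAt.comp (g := fun q : B × F => (⟨q.1, e₁.symm q.1 q.2⟩ : TotalSpace F E₁))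
      (f := fun w : TotalSpace F E₂ => (w.proj, A' w.proj (e₂ w).2)) ?_
      (hproj.prodMk ((ContinuousAt.comp (f := TotalSpace.proj) (g := A') hA'c hproj).clm_apply hw))
    exact e₁.continuousOn_symm.continuousAt
      ((e₁.open_baseSet.prod isOpen_univ).mem_nhds ⟨hw₀.1, mem_univ _⟩)
  refine key.congr ?_
  filter_upwards [hproj.eventually (hS.mem_nhds hw₀)] with w hw
  rw [hA' _ hw]
  have h : (e₂ w).2 = e₂.continuousLinearMapAt ℝ w.proj w.2 :=
    (congrFun (e₂.coe_linearMapAt_of_mem (R := ℝ) hw.2) w.2).symm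
  congr 1
  rw [h, ← e₁.symmL_apply (R := ℝ) hw.1]
  change e₁.symmL ℝ w.proj (e₁.continuousLinearMapAt ℝ w.proj ((φ w.proj).symm
    (e₂.symmL ℝ w.proj (e₂.continuousLinearMapAt ℝ w.proj w.2)))) = _
  rw [e₁.symmL_continuousLinearMapAt hw.1, e₂.symmL_continuousLinearMapAt hw.2]

/-- A linear map between fibers of a vector bundle that is injective is invertible. -/
theorem exists_continuousLinearEquiv_coe_eq {B F : Type*} [TopologicalSpace B]
    [NormedAddCommGroup F] [NormedSpace ℝ F] [FiniteDimensional ℝ F] {E : B → Type*}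
    [TopologicalSpace (TotalSpace F E)] [∀ p, TopologicalSpace (E p)]
    [∀ p, AddCommGroup (E p)] [∀ p, Module ℝ (E p)] [FiberBundle F E] [VectorBundle ℝ F E]
    {p q : B} (g : E p →ₗ[ℝ] E q) (hg : Function.Injective g) :
    ∃ φ : E p ≃L[ℝ] E q, ∀ v, φ v = g v := by
  let e := (trivializationAt F E p).continuousLinearEquivAt ℝ p
    (mem_baseSet_trivializationAt F E p)
  let e' := (trivializationAt F E q).continuousLinearEquivAt ℝ q
    (mem_baseSet_trivializationAt F E q)
  let h : F →ₗ[ℝ] F := e'.toLinearEquiv.toLinearMap ∘ₗ g ∘ₗ e.symm.toLinearEquiv.toLinearMap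
  have hh : Function.Injective h := e'.injective.comp (hg.comp e.symm.injective)
  refine ⟨(e.trans (LinearEquiv.ofInjectiveEndo h hh).toContinuousLinearEquiv).trans e'.symm,
    fun v => ?_⟩
  simp [h]

variable {M F : Type*} {E : M × unitInterval → Type*}
  [∀ p, AddCommGroup (E p)] [∀ p, Module ℝ (E p)]

open scoped Classical in
/-- Follow the transport `f` for a time `τ * ρ x`, staying inside the unit interval. -/
noncomputable def flowStep (ρ : M → ℝ) (f : ∀ x s t, E (x, s) →ₗ[ℝ] E (x, t)) (τ : ℝ)
    (z : TotalSpace F E) : TotalSpace F E :=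
  if ρ z.proj.1 = 0 then z else
    ⟨(z.proj.1, projIcc 0 1 zero_le_one (z.proj.2 + τ * ρ z.proj.1)), f _ _ _ z.2⟩

theorem flowStep_of_eq_zero {ρ : M → ℝ} {f : ∀ x s t, E (x, s) →ₗ[ℝ] E (x, t)} {τ : ℝ}
    {z : TotalSpace F E} (h : ρ z.proj.1 = 0) : flowStep ρ f τ z = z := if_pos h

theorem le_projIcc_add {s : unitInterval} {r : ℝ} (hr : 0 ≤ r) :
    s ≤ projIcc 0 1 zero_le_one (s + r) := by
  rw [← Subtype.coe_le_coe, coe_projIcc]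
  exact le_max_of_le_right (le_min s.2.2 (le_add_of_nonneg_right hr))

theorem coe_projIcc_add {s : unitInterval} {r : ℝ} (hr : 0 ≤ r) :
    (projIcc (0 : ℝ) 1 zero_le_one (s + r) : ℝ) = min 1 (s + r) := by
  rw [coe_projIcc]
  exact max_eq_right (le_min zero_le_one (add_nonneg s.2.1 hr))

theorem flowStep_fst (ρ : M → ℝ) (f : ∀ x s t, E (x, s) →ₗ[ℝ] E (x, t)) (τ : ℝ)
    (z : TotalSpace F E) : (flowStep ρ f τ z).proj.1 = z.proj.1 := by
  unfold flowStep
  split_ifs <;> rfl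

theorem flowStep_snd {ρ : M → ℝ} (hρ : ∀ x, 0 ≤ ρ x) (f : ∀ x s t, E (x, s) →ₗ[ℝ] E (x, t)) {τ : ℝ}
    (hτ : 0 ≤ τ) (z : TotalSpace F E) :
    ((flowStep ρ f τ z).proj.2 : ℝ) = min 1 (z.proj.2 + τ * ρ z.proj.1) := by
  unfold flowStep
  split_ifs with h
  · simp [h, z.proj.2.2.2]
  · exact coe_projIcc_add (mul_nonneg hτ (hρ _))

variable {ι : Type*}

/-- The composition of the steps indexed by a list. -/
noncomputable def flow (ρ : ι → M → ℝ) (f : ι → ∀ x s t, E (x, s) →ₗ[ℝ] E (x, t)) (l : List ι)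
    (τ : ℝ) (z : TotalSpace F E) : TotalSpace F E :=
  l.foldl (fun z i => flowStep (ρ i) (f i) τ z) z

theorem flow_fst (ρ : ι → M → ℝ) (f : ι → ∀ x s t, E (x, s) →ₗ[ℝ] E (x, t)) (l : List ι) (τ : ℝ)
    (z : TotalSpace F E) : (flow ρ f l τ z).proj.1 = z.proj.1 := by
  induction l generalizing z with
  | nil => rfl
  | cons i l ih => exact (ih _).trans (flowStep_fst _ _ _ _)

theorem flow_snd {ρ : ι → M → ℝ} (hρ : ∀ i x, 0 ≤ ρ i x)
    (f : ι → ∀ x s t, E (x, s) →ₗ[ℝ] E (x, t)) (l : List ι) {τ : ℝ} (hτ : 0 ≤ τ)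
    (z : TotalSpace F E) :
    ((flow ρ f l τ z).proj.2 : ℝ) =
      min 1 (z.proj.2 + τ * (l.map fun i => ρ i z.proj.1).sum) := by
  induction l generalizing z with
  | nil => simp [flow, z.proj.2.2.2]
  | cons i l ih =>
    have h := ih (flowStep (ρ i) (f i) τ z)
    rw [flowStep_fst, flowStep_snd (hρ i) _ hτ] at h
    refine h.trans ?_
    have h0 : 0 ≤ τ * (l.map fun i => ρ i z.proj.1).sum :=
      mul_nonneg hτ (List.sum_nonneg (by simpa using fun i _ => hρ i z.proj.1))
    rw [List.map_cons, List.sum_cons, mul_add, ← add_assoc, ← min_add_add_right, ← min_assoc,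
      min_eq_left (le_add_of_nonneg_right h0)]

theorem flow_eq_flow_of_filter_eq (ρ : ι → M → ℝ) (f : ι → ∀ x s t, E (x, s) →ₗ[ℝ] E (x, t))
    (τ : ℝ) (z : TotalSpace F E) (p : ι → Bool) (hp : ∀ i, p i = false → ρ i z.proj.1 = 0)
    (l : List ι) : flow ρ f (l.filter p) τ z = flow ρ f l τ z := by
  induction l generalizing z with
  | nil => rfl
  | cons i l ih =>
    cases h : p i with
    | false =>
      rw [List.filter_cons_of_neg (by simp [h]), ih z hp]
      simp only [flow, List.foldl_cons, flowStep_of_eq_zero (hp i h)]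
    | true =>
      rw [List.filter_cons_of_pos h]
      exact ih _ fun j hj => by rw [flowStep_fst, hp j hj]

variable {ω : ∀ p, E p →ₗ[ℝ] E p →ₗ[ℝ] ℝ}

/-- A self-map of the total space covering a map of the base which preserves the first coordinate,
and restricting to symplectic linear maps between fibers. -/
def IsFiberwiseSymplectic (ω : ∀ p, E p →ₗ[ℝ] E p →ₗ[ℝ] ℝ)
    (Φ : TotalSpace F E → TotalSpace F E) : Prop :=
  ∀ x s, ∃ t, ∃ g : E (x, s) →ₗ[ℝ] E (x, t),
    (∀ u v, ω (x, t) (g u) (g v) = ω (x, s) u v) ∧ ∀ v, Φ ⟨(x, s), v⟩ = ⟨(x, t), g v⟩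

theorem IsFiberwiseSymplectic.id : IsFiberwiseSymplectic ω (id : TotalSpace F E → _) :=
  fun _ s => ⟨s, LinearMap.id, fun _ _ => rfl, fun _ => rfl⟩

theorem IsFiberwiseSymplectic.comp {Φ Ψ : TotalSpace F E → TotalSpace F E}
    (hΦ : IsFiberwiseSymplectic ω Φ) (hΨ : IsFiberwiseSymplectic ω Ψ) :
    IsFiberwiseSymplectic ω (Φ ∘ Ψ) := by
  intro x s
  obtain ⟨t, g, hg, hΨg⟩ := hΨ x s
  obtain ⟨r, h, hh, hΦh⟩ := hΦ x t
  exact ⟨r, h ∘ₗ g, fun u v => by simp [hh, hg], fun v => by simp [hΨg, hΦh]⟩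

/-- A family of linear maps `E (x, s) → E (x, t)` which, over points `x ∈ U` and times `s ≤ t`
in `J`, is continuous, equal to the identity for `s = t`, and preserves `ω`. -/
structure IsSymplecticTransport (F : Type*) [TopologicalSpace (TotalSpace F E)]
    (ω : ∀ p, E p →ₗ[ℝ] E p →ₗ[ℝ] ℝ) (U : Set M) (J : Set unitInterval)
    (f : ∀ x s t, E (x, s) →ₗ[ℝ] E (x, t)) : Prop where
  continuousOn : ContinuousOn
    (fun q : TotalSpace F E × unitInterval =>
      (⟨(q.1.proj.1, q.2), f q.1.proj.1 q.1.proj.2 q.2 q.1.2⟩ : TotalSpace F E))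
    {q | q.1.proj.1 ∈ U ∧ q.1.proj.2 ∈ J ∧ q.2 ∈ J ∧ q.1.proj.2 ≤ q.2}
  map_self : ∀ x ∈ U, ∀ s ∈ J, ∀ v, f x s s v = v
  map_form : ∀ x ∈ U, ∀ s ∈ J, ∀ t ∈ J, s ≤ t → ∀ u v,
    ω (x, t) (f x s t u) (f x s t v) = ω (x, s) u v

/-- A function is continuous on a set once it is so on its parts below and above a level. -/
theorem continuousOn_of_le_of_ge {X Y α : Type*} [TopologicalSpace X] [TopologicalSpace Y]
    [TopologicalSpace α] [LinearOrder α] [OrderClosedTopology α] {f : X → Y} {S : Set X} {g : X → α}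
    (hg : Continuous g) (b : α) (h₁ : ContinuousOn f (S ∩ {q | g q ≤ b}))
    (h₂ : ContinuousOn f (S ∩ {q | b ≤ g q})) : ContinuousOn f S := by
  intro x hx
  have hS : S = (S ∩ {q | g q ≤ b}) ∪ (S ∩ {q | b ≤ g q}) := by
    rw [← inter_union_distrib_left, eq_comm, inter_eq_left]
    exact fun q _ => le_total (g q) b
  rw [hS]
  refine ContinuousWithinAt.union ?_ ?_
  · by_cases h : g x ≤ b
    · exact h₁ x ⟨hx, h⟩
    · refine continuousWithinAt_of_notMem_closure fun hc => h ?_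
      exact (isClosed_le hg continuous_const).closure_subset_iff.2 inter_subset_right hc
  · by_cases h : b ≤ g x
    · exact h₂ x ⟨hx, h⟩
    · refine continuousWithinAt_of_notMem_closure fun hc => h ?_
      exact (isClosed_le continuous_const hg).closure_subset_iff.2 inter_subset_right hc

variable [TopologicalSpace (TotalSpace F E)]

theorem IsSymplecticTransport.mono {U U' : Set M} {J J' : Set unitInterval}
    {f : ∀ x s t, E (x, s) →ₗ[ℝ] E (x, t)} (h : IsSymplecticTransport F ω U J f)
    (hU : U' ⊆ U) (hJ : J' ⊆ J) : IsSymplecticTransport F ω U' J' f where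
  continuousOn := h.continuousOn.mono fun _ hq => ⟨hU hq.1, hJ hq.2.1, hJ hq.2.2.1, hq.2.2.2⟩
  map_self x hx s hs := h.map_self x (hU hx) s (hJ hs)
  map_form x hx s hs t ht := h.map_form x (hU hx) s (hJ hs) t (hJ ht)

theorem IsSymplecticTransport.flowStep_eq {U : Set M} {f : ∀ x s t, E (x, s) →ₗ[ℝ] E (x, t)}
    (hf : IsSymplecticTransport F ω U univ f) (ρ : M → ℝ) (τ : ℝ) {z : TotalSpace F E}
    (hz : z.proj.1 ∈ U) :
    flowStep ρ f τ z =
      ⟨(z.proj.1, projIcc 0 1 zero_le_one (z.proj.2 + τ * ρ z.proj.1)), f _ _ _ z.2⟩ := by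
  unfold flowStep
  split_ifs with h
  · have hs : projIcc 0 1 zero_le_one ((z.proj.2 : ℝ) + τ * ρ z.proj.1) = z.proj.2 := by
      rw [h, mul_zero, add_zero, projIcc_val]
    rw [hs, hf.map_self _ hz _ (mem_univ _)]
  · rfl

variable [TopologicalSpace M]

theorem IsSymplecticTransport.continuous_flowStep {U : Set M} (hU : IsOpen U)
    {f : ∀ x s t, E (x, s) →ₗ[ℝ] E (x, t)} (hf : IsSymplecticTransport F ω U univ f)
    (hproj : Continuous (TotalSpace.proj : TotalSpace F E → M × unitInterval))
    {ρ : M → ℝ} (hρ : Continuous ρ) (hρ0 : ∀ x, 0 ≤ ρ x) (hρU : tsupport ρ ⊆ U) :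
    Continuous fun q : unitInterval × TotalSpace F E => flowStep ρ f q.1 q.2 := by
  have hx : Continuous fun q : unitInterval × TotalSpace F E => q.2.proj.1 := by fun_prop
  refine continuous_iff_continuousAt.2 fun q => ?_
  by_cases hq : q.2.proj.1 ∈ U
  · have hUq : {q : unitInterval × TotalSpace F E | q.2.proj.1 ∈ U} ∈ 𝓝 q :=
      (hU.preimage hx).mem_nhds hq
    have hg : Continuous fun q : unitInterval × TotalSpace F E =>
        (q.2, projIcc (0 : ℝ) 1 zero_le_one (q.2.proj.2 + q.1 * ρ q.2.proj.1)) := by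
      refine continuous_snd.prodMk (continuous_projIcc.comp ?_)
      fun_prop
    refine ContinuousOn.continuousAt ?_ hUq
    refine (hf.continuousOn.comp hg.continuousOn fun q hq => ?_).congr fun q hq =>
      hf.flowStep_eq ρ _ hq
    exact ⟨hq, mem_univ _, mem_univ _, le_projIcc_add (mul_nonneg q.1.2.1 (hρ0 _))⟩
  · have hUq : {q : unitInterval × TotalSpace F E | q.2.proj.1 ∈ (tsupport ρ)ᶜ} ∈ 𝓝 q :=
      ((isClosed_tsupport ρ).isOpen_compl.preimage hx).mem_nhds fun h => hq (hρU h)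
    refine continuousAt_snd.congr (Filter.mem_of_superset hUq fun q hq => ?_)
    exact (flowStep_of_eq_zero (image_eq_zero_of_notMem_tsupport hq)).symm

theorem IsSymplecticTransport.isFiberwiseSymplectic_flowStep {U : Set M}
    {f : ∀ x s t, E (x, s) →ₗ[ℝ] E (x, t)} (hf : IsSymplecticTransport F ω U univ f)
    {ρ : M → ℝ} (hρ0 : ∀ x, 0 ≤ ρ x) (hρU : tsupport ρ ⊆ U) {τ : ℝ} (hτ : 0 ≤ τ) :
    IsFiberwiseSymplectic ω (flowStep ρ f τ : TotalSpace F E → _) := by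
  intro x s
  by_cases hx : x ∈ U
  · exact ⟨_, f x s _, hf.map_form x hx s (mem_univ _) _ (mem_univ _)
      (le_projIcc_add (mul_nonneg hτ (hρ0 x))), fun v => hf.flowStep_eq ρ τ hx⟩
  · exact ⟨s, LinearMap.id, fun _ _ => rfl, fun v =>
      flowStep_of_eq_zero (image_eq_zero_of_notMem_tsupport fun h => hx (hρU h))⟩

/-- Transports over consecutive time intervals can be concatenated. -/
theorem IsSymplecticTransport.concat {U : Set M} {a b c : unitInterval} (hab : a ≤ b) (hbc : b ≤ c)
    (hproj : Continuous (TotalSpace.proj : TotalSpace F E → M × unitInterval))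
    {f₁ f₂ : ∀ x s t, E (x, s) →ₗ[ℝ] E (x, t)} (h₁ : IsSymplecticTransport F ω U (Icc a b) f₁)
    (h₂ : IsSymplecticTransport F ω U (Icc b c) f₂) :
    ∃ f, IsSymplecticTransport F ω U (Icc a c) f := by
  classical
  let f : ∀ x s t, E (x, s) →ₗ[ℝ] E (x, t) := fun x s t =>
    if t ≤ b then f₁ x s t else if b ≤ s then f₂ x s t else f₂ x b t ∘ₗ f₁ x s b
  have hlow : ∀ x s t, t ≤ b → f x s t = f₁ x s t := fun x s t h => if_pos h
  have hmid : ∀ x ∈ U, ∀ s ∈ Icc a b, ∀ t ∈ Icc b c, f x s t = f₂ x b t ∘ₗ f₁ x s b := by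
    intro x hx s hs t ht
    ext v
    by_cases htb : t ≤ b
    · obtain rfl := le_antisymm htb ht.1
      simp [f, h₂.map_self x hx t ht]
    · by_cases hbs : b ≤ s
      · obtain rfl := le_antisymm hbs hs.2
        simp [f, htb, h₁.map_self x hx b hs]
      · simp [f, htb, hbs]
  have hhigh : ∀ x ∈ U, ∀ s ∈ Icc b c, ∀ t ∈ Icc b c, s ≤ t → f x s t = f₂ x s t := by
    intro x hx s hs t ht hst
    ext v
    by_cases htb : t ≤ b
    · obtain rfl := le_antisymm htb ht.1
      obtain rfl := le_antisymm hst hs.1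
      simp [f, h₁.map_self x hx s ⟨hab, le_rfl⟩, h₂.map_self x hx s ht]
    · simp [f, htb, hs.1]
  refine ⟨f, ⟨?_, ?_, ?_⟩⟩
  · have hps : Continuous fun q : TotalSpace F E × unitInterval => q.1.proj.2 := by fun_prop
    refine continuousOn_of_le_of_ge continuous_snd b ?_
      (continuousOn_of_le_of_ge hps b ?_ ?_)
    · refine (h₁.continuousOn.mono ?_).congr ?_
      · rintro q ⟨⟨hU, hs, ht, hst⟩, hb⟩
        exact ⟨hU, ⟨hs.1, hst.trans hb⟩, ⟨ht.1, hb⟩, hst⟩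
      · rintro q ⟨-, hb⟩
        simp only [hlow _ _ _ hb]
    · have hmap : ContinuousOn (fun q : TotalSpace F E × unitInterval =>
          ((⟨(q.1.proj.1, b), f₁ q.1.proj.1 q.1.proj.2 b q.1.2⟩ : TotalSpace F E), q.2))
          {q | q.1.proj.1 ∈ U ∧ q.1.proj.2 ∈ Icc a b ∧ q.2 ∈ Icc b c} := by
        refine ContinuousOn.prodMk ?_ continuousOn_snd
        exact h₁.continuousOn.comp (f := fun q : TotalSpace F E × unitInterval => (q.1, b))
          (by fun_prop) fun q hq => ⟨hq.1, hq.2.1, ⟨hab, le_rfl⟩, hq.2.1.2⟩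
      refine ((h₂.continuousOn.comp hmap ?_).mono ?_).congr ?_
      · exact fun q hq => ⟨hq.1, ⟨le_rfl, hbc⟩, hq.2.2, hq.2.2.1⟩
      · rintro q ⟨⟨⟨hU, hs, ht, hst⟩, hb⟩, hb'⟩
        exact ⟨hU, ⟨hs.1, hb'⟩, ⟨hb, ht.2⟩⟩
      · rintro q ⟨⟨⟨hU, hs, ht, hst⟩, hb⟩, hb'⟩
        simp only [hmid _ hU _ ⟨hs.1, hb'⟩ _ ⟨hb, ht.2⟩, Function.comp_apply, LinearMap.comp_apply]
    · refine (h₂.continuousOn.mono ?_).congr ?_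
      · rintro q ⟨⟨⟨hU, hs, ht, hst⟩, hb⟩, hb'⟩
        exact ⟨hU, ⟨hb', hs.2⟩, ⟨hb, ht.2⟩, hst⟩
      · rintro q ⟨⟨⟨hU, hs, ht, hst⟩, hb⟩, hb'⟩
        simp only [hhigh _ hU _ ⟨hb', hs.2⟩ _ ⟨hb, ht.2⟩ hst]
  · intro x hx s hs v
    rcases le_total s b with h | h
    · rw [hlow _ _ _ h, h₁.map_self x hx s ⟨hs.1, h⟩]
    · rw [hhigh x hx s ⟨h, hs.2⟩ s ⟨h, hs.2⟩ le_rfl, h₂.map_self x hx s ⟨h, hs.2⟩]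
  · intro x hx s hs t ht hst u v
    rcases le_total t b with h | h
    · rw [hlow _ _ _ h, h₁.map_form x hx s ⟨hs.1, hst.trans h⟩ t ⟨ht.1, h⟩ hst]
    · rcases le_total s b with h' | h'
      · rw [hmid x hx s ⟨hs.1, h'⟩ t ⟨h, ht.2⟩, LinearMap.comp_apply, LinearMap.comp_apply,
          h₂.map_form x hx b ⟨le_rfl, hbc⟩ t ⟨h, ht.2⟩ h,
          h₁.map_form x hx s ⟨hs.1, h'⟩ b ⟨hab, le_rfl⟩ h']
      · rw [hhigh x hx s ⟨h', hs.2⟩ t ⟨h, ht.2⟩ hst,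
          h₂.map_form x hx s ⟨h', hs.2⟩ t ⟨h, ht.2⟩ hst]

/-- Transports over the members of an open cover of the base can be glued to a global one. -/
theorem exists_global_symplectic_transport [ParacompactSpace M] [T2Space M]
    (hproj : Continuous (TotalSpace.proj : TotalSpace F E → M × unitInterval))
    (hloc : ∀ x : M, ∃ U : Set M, IsOpen U ∧ x ∈ U ∧ ∃ f, IsSymplecticTransport F ω U univ f) :
    ∃ φ : ∀ x t, E (x, 0) →ₗ[ℝ] E (x, t), (∀ x v, φ x 0 v = v) ∧
      (∀ x t u v, ω (x, t) (φ x t u) (φ x t v) = ω (x, 0) u v) ∧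
      Continuous fun z : TotalSpace F ((fun p : M × unitInterval => (p.1, 0)) *ᵖ E) =>
        (⟨z.proj, φ z.proj.1 z.proj.2 z.2⟩ : TotalSpace F E) := by
  classical
  choose U hU hxU f hf using hloc
  obtain ⟨ρ, hρU⟩ := PartitionOfUnity.exists_isSubordinate isClosed_univ U hU
    fun x _ => mem_iUnion.2 ⟨x, hxU x⟩
  let _ : LinearOrder M := linearOrderOfSTO WellOrderingRel
  have hstep : ∀ (l : List M), Continuous fun q : unitInterval × TotalSpace F E =>
      flow (fun i => ρ i) f l q.1 q.2 := by
    intro l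
    induction l with
    | nil => exact continuous_snd
    | cons i l ih =>
      exact ih.comp (continuous_fst.prodMk ((hf i).continuous_flowStep (hU i) hproj
        (ρ i).continuous (ρ.nonneg i) (hρU i)))
  have hsymp : ∀ (l : List M) (τ : unitInterval),
      IsFiberwiseSymplectic ω (flow (F := F) (fun i => ρ i) f l τ) := by
    intro l τ
    induction l with
    | nil => exact IsFiberwiseSymplectic.id
    | cons i l ih =>
      exact ih.comp ((hf i).isFiberwiseSymplectic_flowStep (ρ.nonneg i) (hρU i) τ.2.1)
  let Φ : unitInterval → TotalSpace F E → TotalSpace F E := fun τ z =>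
    flow (fun i => ρ i) f ((ρ.finsupport z.proj.1).sort) τ z
  have hΦ_sort : ∀ (S : Finset M) (τ : unitInterval) (z : TotalSpace F E),
      ρ.finsupport z.proj.1 ⊆ S → Φ τ z = flow (fun i => ρ i) f S.sort τ z := by
    intro S τ z hS
    have hfilter : (ρ.finsupport z.proj.1).sort =
        S.sort.filter fun i => decide (i ∈ ρ.finsupport z.proj.1) := by
      refine List.Perm.eq_of_pairwise' (Finset.pairwise_sort _ _)
        ((Finset.pairwise_sort _ _).filter _) ?_
      refine (List.perm_ext_iff_of_nodup (Finset.sort_nodup _ _)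
        ((Finset.sort_nodup _ _).filter _)).2 fun i => ?_
      simpa using fun h => hS h
    simp only [Φ]
    rw [hfilter]
    refine flow_eq_flow_of_filter_eq _ f _ z _ (fun i hi => ?_) _
    simpa using hi
  have hΦ : Continuous fun q : unitInterval × TotalSpace F E => Φ q.1 q.2 := by
    refine continuous_iff_continuousAt.2 fun q => ?_
    have hx : Continuous fun q : unitInterval × TotalSpace F E => q.2.proj.1 := by fun_prop
    refine (hstep (ρ.fintsupport q.2.proj.1).sort).continuousAt.congr ?_
    filter_upwards [hx.continuousAt.eventually (ρ.eventually_finsupport_subset q.2.proj.1)]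
      with r hr
    exact (hΦ_sort _ r.1 r.2 hr).symm
  have hΦ0 : ∀ x t v, ∃ w, Φ t ⟨(x, 0), v⟩ = ⟨(x, t), w⟩ := by
    intro x t v
    have h₁ := flow_fst (F := F) (fun i => ρ i) f (ρ.finsupport x).sort t ⟨(x, 0), v⟩
    have h₂ := flow_snd (F := F) (ρ := fun i => ρ i) ρ.nonneg f (ρ.finsupport x).sort t.2.1
      ⟨(x, 0), v⟩
    have hsum : ((ρ.finsupport x).sort.map fun i => ρ i x).sum = 1 := by
      rw [← ρ.sum_finsupport (mem_univ x), ← List.sum_toFinset _ (Finset.sort_nodup _ _),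
        Finset.sort_toFinset]
    rw [hsum, mul_one, show (((0 : unitInterval) : ℝ)) = 0 from rfl, zero_add,
      min_eq_right t.2.2] at h₂
    have h₃ : (Φ t ⟨(x, 0), v⟩).proj = (x, t) := Prod.ext h₁ (Subtype.ext h₂)
    generalize Φ t ⟨(x, 0), v⟩ = z at h₃
    obtain ⟨p, w⟩ := z
    obtain rfl : p = (x, t) := h₃
    exact ⟨w, rfl⟩
  have hex : ∀ x t, ∃ g : E (x, 0) →ₗ[ℝ] E (x, t),
      (∀ u v, ω (x, t) (g u) (g v) = ω (x, 0) u v) ∧ ∀ v, Φ t ⟨(x, 0), v⟩ = ⟨(x, t), g v⟩ := by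
    intro x t
    obtain ⟨t', g, hg, hΦg⟩ := hsymp (ρ.finsupport x).sort t x 0
    obtain ⟨w, hw⟩ := hΦ0 x t 0
    have htt : (x, t') = (x, t) := congrArg TotalSpace.proj ((hΦg 0).symm.trans hw)
    obtain rfl : t' = t := congrArg Prod.snd htt
    exact ⟨g, hg, hΦg⟩
  choose φ hφ hΦφ using hex
  refine ⟨φ, fun x v => ?_, hφ, ?_⟩
  · have hid : ∀ (l : List M) (z : TotalSpace F E), flow (fun i => ρ i) f l 0 z = z := by
      intro l z
      induction l generalizing z with
      | nil => rfl
      | cons i l ih =>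
        refine (ih _).trans ?_
        change flowStep (ρ i) (f i) 0 z = z
        by_cases h : z.proj.1 ∈ U i
        · rw [(hf i).flowStep_eq (ρ i) 0 h]
          have hs : projIcc 0 1 zero_le_one ((z.proj.2 : ℝ) + 0 * ρ i z.proj.1) = z.proj.2 := by
            rw [zero_mul, add_zero, projIcc_val]
          rw [hs, (hf i).map_self _ h _ (mem_univ _)]
        · exact flowStep_of_eq_zero (image_eq_zero_of_notMem_tsupport fun h' => h (hρU i h'))
    have := (hΦφ x 0 v).symm.trans (hid _ _)
    simpa using this
  · have hlift : Continuous
        fun z : TotalSpace F ((fun p : M × unitInterval => (p.1, (0 : unitInterval))) *ᵖ E) =>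
          (z.proj.2, Pullback.lift (fun p : M × unitInterval => (p.1, (0 : unitInterval))) z) :=
      (continuous_snd.comp (Pullback.continuous_proj F E _)).prodMk
        (Pullback.continuous_lift F E _)
    exact (hΦ.comp hlift).congr fun z => hΦφ z.proj.1 z.proj.2 z.2

variable [NormedAddCommGroup F] [NormedSpace ℝ F] [∀ p, TopologicalSpace (E p)]
  [FiberBundle F E] [VectorBundle ℝ F E]

/-- Symplectic transports exist near every point of the cylinder. -/
theorem exists_isSymplecticTransport_nhds [FiniteDimensional ℝ F]
    (hω_cont : Continuous (fun z : TotalSpace (F × F) (E ×ᵇ E) => ω z.proj z.2.1 z.2.2))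
    (hω_alt : ∀ p v, ω p v v = 0) (hω_nondeg : ∀ p u, (∀ v, ω p u v = 0) → u = 0)
    (p₀ : M × unitInterval) :
    ∃ U : Set M, IsOpen U ∧ p₀.1 ∈ U ∧ ∃ J : Set unitInterval, IsOpen J ∧ p₀.2 ∈ J ∧
      ∃ f, IsSymplecticTransport F ω U J f := by
  let e := trivializationAt F E p₀
  have hp₀ : p₀ ∈ e.baseSet := FiberBundle.mem_baseSet_trivializationAt F E p₀
  let Ω : M × unitInterval → F →L[ℝ] F →L[ℝ] ℝ := fun p =>
    ((ω p).compl₁₂ (e.symmₗ ℝ p) (e.symmₗ ℝ p)).toContinuousBilinearMap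
  have hΩ : ∀ p u v, Ω p u v = ω p (e.symmₗ ℝ p u) (e.symmₗ ℝ p v) := fun p u v => rfl
  have hΩ_cont : ContinuousOn Ω e.baseSet := by
    refine continuousOn_clm_apply.2 fun u => continuousOn_clm_apply.2 fun v => ?_
    have hsec : ∀ w : F, ContinuousOn (fun p => TotalSpace.mk' F p (e.symmₗ ℝ p w)) e.baseSet := by
      intro w
      refine (e.continuousOn_symm.comp (f := fun p => (p, w)) (by fun_prop)
        fun p hp => ⟨hp, mem_univ _⟩).congr fun p hp => ?_
      simp only [Function.comp_apply, e.symmₗ_apply hp]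
    refine hω_cont.comp_continuousOn (f := fun p =>
      (⟨p, (e.symmₗ ℝ p u, e.symmₗ ℝ p v)⟩ : TotalSpace (F × F) (E ×ᵇ E))) ?_
    rw [(FiberBundle.Prod.isInducing_diag F E F E).continuousOn_iff]
    exact (hsec u).prodMk (hsec v)
  obtain ⟨W, hWo, hW0, B, hB, hBW⟩ := exists_continuousOn_symplectic_frame (Ω p₀)
    (fun u => hω_alt _ _) (fun u hu => by
      have h0 : e.symmₗ ℝ p₀ u = 0 := hω_nondeg p₀ _ fun v => by
        have := hu (e.linearMapAt ℝ p₀ v)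
        rwa [hΩ, e.symmₗ_linearMapAt hp₀] at this
      rw [← e.linearMapAt_symmₗ (R := ℝ) hp₀ u, h0, map_zero])
  have hN : e.baseSet ∩ Ω ⁻¹' W ∈ 𝓝 p₀ :=
    (hΩ_cont.isOpen_inter_preimage e.open_baseSet hWo).mem_nhds ⟨hp₀, hW0⟩
  obtain ⟨U, J, hU, hpU, hJ, hpJ, hUJ⟩ := mem_nhds_prod_iff'.1 hN
  let C : M × unitInterval → F →L[ℝ] F := fun p => B (Ω p)
  have hC : ContinuousOn C (U ×ˢ J) :=
    hB.comp (hΩ_cont.mono fun p hp => (hUJ hp).1) fun p hp => (hUJ hp).2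
  have hCu : ∀ p ∈ U ×ˢ J, IsUnit (C p) := fun p hp => (hBW _ (hUJ hp).2).1
  let C' : M × unitInterval → F →L[ℝ] F := fun p => Ring.inverse (C p)
  have hCi : ContinuousOn C' (U ×ˢ J) := by
    intro p hp
    obtain ⟨w, hw⟩ := hCu p hp
    have := NormedRing.inverse_continuousAt w
    rw [hw] at this
    exact this.comp_continuousWithinAt (hC p hp)
  have hCform : ∀ p ∈ U ×ˢ J, ∀ u v, Ω p₀ (C p u) (C p v) = Ω p u v := fun p hp =>
    (hBW _ (hUJ hp).2).2 fun u => hω_alt _ _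
  have hCC : ∀ p ∈ U ×ˢ J, ∀ v, C p (C' p v) = v := fun p hp v => by
    simp only [C']
    rw [← mul_apply_eq_comp, Ring.mul_inverse_cancel _ (hCu p hp), one_apply_eq_self]
  have hCC' : ∀ p ∈ U ×ˢ J, ∀ v, C' p (C p v) = v := fun p hp v => by
    simp only [C']
    rw [← mul_apply_eq_comp, Ring.inverse_mul_cancel _ (hCu p hp), one_apply_eq_self]
  have hCiform : ∀ p ∈ U ×ˢ J, ∀ u v,
      Ω p (C' p u) (C' p v) = Ω p₀ u v := fun p hp u v => by
    rw [← hCform p hp, hCC p hp, hCC p hp]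
  refine ⟨U, hU, hpU, J, hJ, hpJ, fun x s t =>
    e.symmₗ ℝ (x, t) ∘ₗ (C' (x, t) : F →ₗ[ℝ] F) ∘ₗ (C (x, s) : F →ₗ[ℝ] F) ∘ₗ
      e.linearMapAt ℝ (x, s), ⟨?_, ?_, ?_⟩⟩
  · have hproj : Continuous (TotalSpace.proj : TotalSpace F E → M × unitInterval) :=
      FiberBundle.continuous_proj F E
    set D : Set (TotalSpace F E × unitInterval) :=
      {q | q.1.proj.1 ∈ U ∧ q.1.proj.2 ∈ J ∧ q.2 ∈ J ∧ q.1.proj.2 ≤ q.2} with hD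
    have hs : MapsTo (fun q : TotalSpace F E × unitInterval => q.1.proj) D (U ×ˢ J) :=
      fun q hq => ⟨hq.1, hq.2.1⟩
    have ht : MapsTo (fun q : TotalSpace F E × unitInterval => (q.1.proj.1, q.2)) D (U ×ˢ J) :=
      fun q hq => ⟨hq.1, hq.2.2.1⟩
    have he : ContinuousOn (fun q : TotalSpace F E × unitInterval => (e q.1).2) D :=
      (continuous_snd.comp_continuousOn e.continuousOn).comp continuousOn_fst
        fun q hq => e.mem_source.2 (hUJ (hs hq)).1
    have hv : ContinuousOn (fun q : TotalSpace F E × unitInterval =>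
        ((q.1.proj.1, q.2), C' (q.1.proj.1, q.2) (C q.1.proj (e q.1).2))) D := by
      refine ContinuousOn.prodMk (by fun_prop) ?_
      exact (hCi.comp (by fun_prop) ht).clm_apply ((hC.comp (by fun_prop) hs).clm_apply he)
    refine (e.continuousOn_symm.comp hv fun q hq => ⟨(hUJ (ht hq)).1, mem_univ _⟩).congr ?_
    intro q hq
    simp [C', e.symmₗ_apply (hUJ (ht hq)).1, (hUJ (hs hq)).1]
  · intro x hx s hs v
    simp [hCC' (x, s) ⟨hx, hs⟩, e.symmₗ_linearMapAt (hUJ (mk_mem_prod hx hs)).1]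
  · intro x hx s hs t ht _ u v
    simp only [LinearMap.comp_apply, ContinuousLinearMap.coe_coe]
    rw [← hΩ, hCiform (x, t) ⟨hx, ht⟩, hCform (x, s) ⟨hx, hs⟩, hΩ,
      e.symmₗ_linearMapAt (hUJ (mk_mem_prod hx hs)).1,
      e.symmₗ_linearMapAt (hUJ (mk_mem_prod hx hs)).1]

/-- Symplectic transports over the whole time interval exist near every point of the base. -/
theorem exists_isSymplecticTransport_univ [FiniteDimensional ℝ F]
    (hω_cont : Continuous (fun z : TotalSpace (F × F) (E ×ᵇ E) => ω z.proj z.2.1 z.2.2))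
    (hω_alt : ∀ p v, ω p v v = 0) (hω_nondeg : ∀ p u, (∀ v, ω p u v = 0) → u = 0) (x₀ : M) :
    ∃ U : Set M, IsOpen U ∧ x₀ ∈ U ∧ ∃ f, IsSymplecticTransport F ω U univ f := by
  choose U hU hxU J hJ htJ f hf using fun t : unitInterval =>
    exists_isSymplecticTransport_nhds hω_cont hω_alt hω_nondeg (x₀, t)
  obtain ⟨τ, hτ0, hτm, ⟨n, hn⟩, hτ⟩ := exists_monotone_Icc_subset_open_cover_unitInterval hJ
    fun t _ => mem_iUnion.2 ⟨t, htJ t⟩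
  have key : ∀ k, ∃ V : Set M, IsOpen V ∧ x₀ ∈ V ∧
      ∃ g, IsSymplecticTransport F ω V (Icc (τ 0) (τ (k + 1))) g := by
    intro k
    induction k with
    | zero =>
      obtain ⟨i, hi⟩ := hτ 0
      exact ⟨U i, hU i, hxU i, f i, (hf i).mono Subset.rfl hi⟩
    | succ k ih =>
      obtain ⟨V, hV, hxV, g, hg⟩ := ih
      obtain ⟨i, hi⟩ := hτ (k + 1)
      exact ⟨V ∩ U i, hV.inter (hU i), ⟨hxV, hxU i⟩,
        (hg.mono inter_subset_left Subset.rfl).concat (hτm (Nat.zero_le _))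
          (hτm (Nat.le_succ _)) (FiberBundle.continuous_proj F E)
          ((hf i).mono inter_subset_right hi)⟩
  obtain ⟨V, hV, hxV, g, hg⟩ := key n
  refine ⟨V, hV, hxV, g, hg.mono Subset.rfl fun t _ => ?_⟩
  rw [hτ0, hn (n + 1) (Nat.le_succ n)]
  exact ⟨unitInterval.nonneg', unitInterval.le_one'⟩

end Transport

/-- **Lemma A.1, symplectic refinement**: if a topological vector bundle `E` over
`M × [0,1]` (`M` paracompact Hausdorff, typical fiber a finite-dimensional real normed
space `F`) carries a continuous family `ω` of fiberwise alternating nondegenerate bilinear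
forms, then the family of continuous linear isomorphisms `φ x t : E (x,0) ≃ E (x,t)` with
`φ x 0 = id`, whose induced total-space map is a fiberwise-linear homeomorphism from the
pullback of `E|_{M×{0}}` to `E`, can be chosen fiberwise symplectic:
`ω (x,t) (φ x t u) (φ x t v) = ω (x,0) u v`. -/
theorem bundle_over_cylinder_stability_symplectic
    {M : Type*} [TopologicalSpace M] [ParacompactSpace M] [T2Space M]
    {F : Type*} [NormedAddCommGroup F] [NormedSpace ℝ F] [FiniteDimensional ℝ F]
    (E : M × unitInterval → Type*)
    [TopologicalSpace (TotalSpace F E)] [∀ p, TopologicalSpace (E p)]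
    [∀ p, AddCommGroup (E p)] [∀ p, Module ℝ (E p)]
    [FiberBundle F E] [VectorBundle ℝ F E]
    -- `ω` is a family of fiberwise bilinear forms on `E` ...
    (ω : ∀ p : M × unitInterval, E p →ₗ[ℝ] E p →ₗ[ℝ] ℝ)
    -- ... which is continuous (as a section of the bundle of bilinear forms on `E`,
    -- expressed via the Whitney sum `E ×ᵇ E`) ...
    (hω_cont : Continuous
      (fun z : TotalSpace (F × F) (E ×ᵇ E) => ω z.proj z.2.1 z.2.2))
    -- ... with each `ω p` alternating ...
    (hω_alt : ∀ (p : M × unitInterval) (v : E p), ω p v v = 0)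
    -- ... and nondegenerate
    (hω_nondeg : ∀ (p : M × unitInterval) (u : E p), (∀ v : E p, ω p u v = 0) → u = 0) :
    ∃ φ : ∀ (x : M) (t : unitInterval), E (x, 0) ≃L[ℝ] E (x, t),
      -- `φ x 0` is the identity
      (∀ x : M, φ x 0 = ContinuousLinearEquiv.refl ℝ (E (x, 0))) ∧
      -- the induced fiberwise-linear total-space map, from the pullback of `E|_{M×{0}}`
      -- along the projection `M × [0,1] → M × {0}` to `E`, covering the identity of
      -- `M × [0,1]`, is a homeomorphism
      IsHomeomorph
        (fun z : TotalSpace F ((fun p : M × unitInterval => (p.1, 0)) *ᵖ E) =>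
          (⟨z.proj, φ z.proj.1 z.proj.2 z.2⟩ : TotalSpace F E)) ∧
      -- and `φ` is fiberwise symplectic
      (∀ (x : M) (t : unitInterval) (u v : E (x, 0)),
        ω (x, t) (φ x t u) (φ x t v) = ω (x, 0) u v) := by
  have hproj := FiberBundle.continuous_proj F E
  obtain ⟨φ, hφ₀, hφω, hφ⟩ := exists_global_symplectic_transport (ω := ω) hproj
    (exists_isSymplecticTransport_univ hω_cont hω_alt hω_nondeg)
  have hinj : ∀ x t, Function.Injective (φ x t) := fun x t =>
    (injective_iff_map_eq_zero _).2 fun u hu => hω_nondeg _ u fun v => by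
      rw [← hφω x t, hu, map_zero, LinearMap.zero_apply]
  choose ψ hψ using fun x t => exists_continuousLinearEquiv_coe_eq (F := F) (φ x t) (hinj x t)
  refine ⟨ψ, fun x => ?_, ?_, fun x t u v => by rw [hψ, hψ, hφω]⟩
  · ext v
    exact (hψ x 0 v).trans (hφ₀ x v)
  · let c : C(M × unitInterval, M × unitInterval) := ⟨fun p => (p.1, 0), by fun_prop⟩
    exact isHomeomorph_totalSpace_map (E₁ := (c : M × unitInterval → M × unitInterval) *ᵖ E)
      (fun p => ψ p.1 p.2) (hφ.congr fun z =>
        TotalSpace.ext rfl (heq_of_eq (hψ _ _ _).symm))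
end
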